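/- Let D be a digraph, X a set of vertices such that D is 2-vertex-connected in X (that is, |V(D)| ≥ 3 and between any two vertices of X there are two internally disjoint directed paths in both directions), and let v be a vertex not in X. If D contains two directed paths from v to X whose vertex sets intersect only in v, and two directed paths from X to v whose vertex sets intersect only in v, then D is 2-vertex-connected in X ∪ {v}. -/

import Mathlib

open Relation

/-- `D` is an orientation of the simple graph `G`: every arc is along an edge,
and every edge gets exactly one direction. -/
def IsOrientation {V : Type*} (G : SimpleGraph V) (D : V → V → Prop) : Prop :=
  (∀ a b, D a b → G.Adj a b) ∧ ∀ a b, G.Adj a b → (D a b ↔ ¬ D b a)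

/-- The digraph given by the relation `D` is strongly connected. -/
def StrongConn {V : Type*} (D : V → V → Prop) : Prop :=
  ∀ a b : V, ReflTransGen D a b

/-- `D - v` is strongly connected. -/
def StrongAvoid {V : Type*} (D : V → V → Prop) (v : V) : Prop :=
  ∀ a b : V, a ≠ v → b ≠ v →
    ReflTransGen (fun x y => D x y ∧ x ≠ v ∧ y ≠ v) a b

/-- `G` is `k`-edge-connected: every nonempty proper vertex set has at least
`k` boundary edges (each crossing edge counted once, ordered with first endpoint inside). -/
def EdgeConn {V : Type*} (G : SimpleGraph V) (k : ℕ) : Prop :=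
  ∀ X : Set V, X.Nonempty → X ≠ Set.univ →
    k ≤ Nat.card {p : V × V // p.1 ∈ X ∧ p.2 ∉ X ∧ G.Adj p.1 p.2}

/-- The digraph `D` is `k`-arc-connected: every nonempty proper vertex set has
at least `k` entering arcs. -/
def ArcConn {V : Type*} (D : V → V → Prop) (k : ℕ) : Prop :=
  ∀ X : Set V, X.Nonempty → X ≠ Set.univ →
    k ≤ Nat.card {p : V × V // D p.1 p.2 ∧ p.1 ∉ X ∧ p.2 ∈ X}

/-- `D` is 2-vertex-connected: at least 3 vertices, strongly connected, and
strongly connected after deleting any vertex. -/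
def TwoVC {V : Type*} (D : V → V → Prop) : Prop :=
  3 ≤ Nat.card V ∧ StrongConn D ∧ ∀ v : V, StrongAvoid D v

/-- `l` is (the vertex sequence of) a directed path from `u` to `v` in `D`. -/
def IsDipath {V : Type*} (D : V → V → Prop) (u v : V) (l : List V) : Prop :=
  l.Chain' D ∧ l.head? = some u ∧ l.getLast? = some v ∧ l.Nodup

/-- `D` is 2-vertex-connected in `X`: `|V| ≥ 3` and between any two distinct
vertices of `X` there are two internally disjoint directed paths. -/
def TwoVCin {V : Type*} (D : V → V → Prop) (X : Set V) : Prop :=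
  3 ≤ Nat.card V ∧ ∀ u ∈ X, ∀ w ∈ X, u ≠ w →
    ∃ l₁ l₂ : List V, IsDipath D u w l₁ ∧ IsDipath D u w l₂ ∧
      ∀ x, x ∈ l₁ → x ∈ l₂ → x = u ∨ x = w

/-- There are two `(v,X)`-paths meeting only in `v` and two `(X,v)`-paths
meeting only in `v`. -/
def PathPairs {V : Type*} (D : V → V → Prop) (X : Set V) (v : V) : Prop :=
  (∃ l₁ l₂ : List V, (∃ x₁ ∈ X, IsDipath D v x₁ l₁) ∧ (∃ x₂ ∈ X, IsDipath D v x₂ l₂) ∧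
      ∀ x, x ∈ l₁ → x ∈ l₂ → x = v) ∧
  (∃ l₁ l₂ : List V, (∃ x₁ ∈ X, IsDipath D x₁ v l₁) ∧ (∃ x₂ ∈ X, IsDipath D x₂ v l₂) ∧
      ∀ x, x ∈ l₁ → x ∈ l₂ → x = v)

/-- `b` is reachable from `a` by a walk all of whose vertices lie in `S`. -/
def RIn {V : Type*} (D : V → V → Prop) (S : Set V) (a b : V) : Prop :=
  a ∈ S ∧ ReflTransGen (fun x y => D x y ∧ y ∈ S) a b

theorem RIn.mono {V : Type*} {D : V → V → Prop} {S T : Set V} {a b : V}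
    (h : RIn D S a b) (hST : S ⊆ T) : RIn D T a b :=
  ⟨hST h.1, h.2.lift id fun _ _ hxy => ⟨hxy.1, hST hxy.2⟩⟩

theorem RIn.right_mem {V : Type*} {D : V → V → Prop} {S : Set V} {a b : V}
    (h : RIn D S a b) : b ∈ S := by
  obtain ⟨ha, h⟩ := h
  rcases ReflTransGen.cases_tail h with h | ⟨c, _, hc⟩
  · exact h ▸ ha
  · exact hc.2

theorem RIn.step {V : Type*} {D : V → V → Prop} {S : Set V} {a b c : V}
    (h : RIn D S a b) (hbc : D b c) (hc : c ∈ S) : RIn D S a c :=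
  ⟨h.1, h.2.tail ⟨hbc, hc⟩⟩

theorem RIn.trans {V : Type*} {D : V → V → Prop} {S : Set V} {a b c : V}
    (h : RIn D S a b) (h' : RIn D S b c) : RIn D S a c :=
  ⟨h.1, h.2.trans h'.2⟩

/-- All vertices of the walk are themselves reachable. -/
theorem RIn.closure {V : Type*} {D : V → V → Prop} {S : Set V} {a b : V}
    (h : RIn D S a b) : RIn D {t | RIn D S a t} a b := by
  obtain ⟨ha, h⟩ := h
  have ha' : a ∈ {t | RIn D S a t} := ⟨ha, .refl⟩
  induction h with
  | refl => exact ⟨ha', .refl⟩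
  | tail h1 h2 ih => exact ih.step h2.1 ⟨ha, h1.tail h2⟩

theorem RIn.pred {V : Type*} {D : V → V → Prop} {S : Set V} {a b : V}
    (h : RIn D S a b) (hab : a ≠ b) : ∃ c, RIn D (S \ {b}) a c ∧ D c b := by
  obtain ⟨ha, h⟩ := h
  have key : ∀ t, ReflTransGen (fun x y => D x y ∧ y ∈ S) a t →
      RIn D (S \ {b}) a t ∨ ∃ c, RIn D (S \ {b}) a c ∧ D c b := by
    intro t ht
    induction ht with
    | refl => exact Or.inl ⟨⟨ha, hab⟩, .refl⟩
    | @tail x y h1 h2 ih =>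
      rcases ih with ih | ih
      · by_cases hy : y = b
        · exact Or.inr ⟨x, ih, hy ▸ h2.1⟩
        · exact Or.inl (ih.step h2.1 ⟨h2.2, hy⟩)
      · exact Or.inr ih
  rcases key b h with h | h
  · exact absurd rfl h.right_mem.2
  · exact h

/-- Last vertex of the walk in `C`. -/
theorem RIn.last {V : Type*} {D : V → V → Prop} {S C : Set V} {a b : V}
    (h : RIn D S a b) (ha : a ∈ C) : ∃ r ∈ C, RIn D ((S \ C) ∪ {r}) r b := by
  obtain ⟨haS, h⟩ := h
  induction h with
  | refl => exact ⟨a, ha, Or.inr rfl, .refl⟩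
  | @tail x y h1 h2 ih =>
    by_cases hy : y ∈ C
    · exact ⟨y, hy, Or.inr rfl, .refl⟩
    · obtain ⟨r, hr, h⟩ := ih
      exact ⟨r, hr, h.step h2.1 (Or.inl ⟨h2.2, hy⟩)⟩

/-- Two internally disjoint walks. -/
def HasPair {V : Type*} (D : V → V → Prop) (u w : V) : Prop :=
  ∃ S T : Set V, RIn D S u w ∧ RIn D T u w ∧ ∀ x, x ∈ S → x ∈ T → x = u ∨ x = w

theorem HasPair.extend {V : Type*} {D : V → V → Prop} {u z y w : V} (huz : u ≠ z)
    (hp : HasPair D u z) (hr : RIn D Set.univ u y) (hd : ¬ RIn D {z}ᶜ u y)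
    (hyw : D y w) (hw : RIn D {z}ᶜ u w) : HasPair D u w := by
  obtain ⟨S, T, hS, hT, hST⟩ := hp
  obtain ⟨c₁, hc₁, hcz₁⟩ := hS.pred huz
  obtain ⟨c₂, hc₂, hcz₂⟩ := hT.pred huz
  -- the region dominated by `z`
  let Z : Set V := {t | ¬ RIn D {z}ᶜ u t}
  have hzZ : z ∈ Z := fun h => h.right_mem rfl
  have hT' : RIn D Z z y := by
    obtain ⟨_, hr⟩ := hr
    have key : ∀ t, ReflTransGen (fun x y => D x y ∧ y ∈ Set.univ) u t → t ∈ Z →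
        RIn D Z z t := by
      intro t ht
      induction ht with
      | refl => intro h; exact absurd ⟨huz, .refl⟩ h
      | @tail p q h1 h2 ih =>
        intro hq
        by_cases hqz : q = z
        · subst hqz; exact ⟨hzZ, .refl⟩
        · exact (ih fun hp => hq (hp.step h2.1 hqz)).step h2.1 hq
    exact key y hr hd
  have main : ∀ A₁ A₂ : Set V, (∀ t ∈ A₁, RIn D A₁ u t) →
      (∃ c ∈ A₂, RIn D A₂ u c ∧ D c z) →
      (∀ x, x ∈ A₁ → x ∈ A₂ → x = u) → (∀ x ∈ A₁, x ∉ Z) → (∀ x ∈ A₂, x ∉ Z) →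
      (∃ r ∈ A₁, RIn D ((Zᶜ \ (A₁ ∪ A₂)) ∪ {r}) r w) → HasPair D u w := by
    rintro A₁ A₂ h1 ⟨c, hc, hcr, hcz⟩ hd h1Z h2Z ⟨r, hr, hrw⟩
    refine ⟨A₁ ∪ (Zᶜ \ (A₁ ∪ A₂)), A₂ ∪ Z ∪ {w}, ?_, ?_, ?_⟩
    · refine ((h1 r hr).mono Set.subset_union_left).trans (hrw.mono ?_)
      rintro x (hx | rfl)
      · exact Or.inr hx
      · exact Or.inl hr
    · refine (((hcr.mono ?_).step hcz (Or.inl (Or.inr hzZ))).trans (hT'.mono ?_)).step hyw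
        (Or.inr rfl)
      · intro x hx; exact Or.inl (Or.inl hx)
      · intro x hx; exact Or.inl (Or.inr hx)
    · rintro x (hx | hx) ((hx' | hx') | hx')
      · exact Or.inl (hd x hx hx')
      · exact absurd hx' (h1Z x hx)
      · exact Or.inr hx'
      · exact absurd (Or.inr hx') hx.2
      · exact absurd hx' hx.1
      · exact Or.inr hx'
  let A₁ : Set V := {t | RIn D (S \ {z}) u t}
  let A₂ : Set V := {t | RIn D (T \ {z}) u t}
  have hA₁ : ∀ t ∈ A₁, RIn D A₁ u t := fun t ht => RIn.closure ht
  have hA₂ : ∀ t ∈ A₂, RIn D A₂ u t := fun t ht => RIn.closure ht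
  have hA : ∀ x, x ∈ A₁ → x ∈ A₂ → x = u := by
    intro x h1 h2
    have h1' := RIn.right_mem h1
    have h2' := RIn.right_mem h2
    rcases hST x h1'.1 h2'.1 with h | h
    · exact h
    · exact absurd h h1'.2
  have hZ₁ : ∀ x ∈ A₁, x ∉ Z := fun x hx hz => hz (RIn.mono hx fun t ht => ht.2)
  have hZ₂ : ∀ x ∈ A₂, x ∉ Z := fun x hx hz => hz (RIn.mono hx fun t ht => ht.2)
  have hu : u ∈ A₁ := ⟨hc₁.1, .refl⟩
  have hw' : RIn D Zᶜ u w := hw.closure.mono fun t ht hz => hz ht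
  obtain ⟨r, hr, hrw⟩ := hw'.last (C := A₁ ∪ A₂) (Or.inl hu)
  rcases hr with hr | hr
  · exact main A₁ A₂ hA₁ ⟨c₂, hc₂, hA₂ _ hc₂, hcz₂⟩ hA hZ₁ hZ₂ ⟨r, hr, hrw⟩
  · refine main A₂ A₁ hA₂ ⟨c₁, hc₁, hA₁ _ hc₁, hcz₁⟩ (fun x h h' => hA x h' h) hZ₂ hZ₁
      ⟨r, hr, ?_⟩
    rwa [Set.union_comm A₂ A₁]

theorem hasPair_of_avoid {V : Type*} {D : V → V → Prop} {u w : V} (huw : u ≠ w)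
    (hr : RIn D Set.univ u w) (h : ∀ z, z ≠ u → z ≠ w → RIn D {z}ᶜ u w) : HasPair D u w := by
  have key : ∀ y, ReflTransGen (fun x y => D x y ∧ y ∈ Set.univ) u y →
      y = u ∨ ∃ z, u ≠ z ∧ HasPair D u z ∧ ¬ RIn D {z}ᶜ u y := by
    intro y hy
    induction hy with
    | refl => exact Or.inl rfl
    | @tail p q h1 h2 ih =>
      by_cases hq : q = u
      · exact Or.inl hq
      right
      have hself : ¬ RIn D {q}ᶜ u q := fun h => h.right_mem rfl
      rcases ih with rfl | ⟨z, huz, hp, hd⟩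
      · refine ⟨q, Ne.symm hq, ⟨{p, q}, {p, q}, ?_, ?_, ?_⟩, hself⟩
        · exact ⟨Or.inl rfl, .single ⟨h2.1, Or.inr rfl⟩⟩
        · exact ⟨Or.inl rfl, .single ⟨h2.1, Or.inr rfl⟩⟩
        · intro x hx _; exact hx
      · by_cases hzq : RIn D {z}ᶜ u q
        · exact ⟨q, Ne.symm hq, hp.extend huz ⟨trivial, h1⟩ hd h2.1 hzq, hself⟩
        · exact ⟨z, huz, hp, hzq⟩
  rcases key w hr.2 with h' | ⟨z, huz, hp, hd⟩
  · exact absurd h'.symm huw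
  · by_cases hz : z = w
    · exact hz ▸ hp
    · exact absurd (h z (Ne.symm huz) hz) hd

theorem RIn.exists_dipath {V : Type*} {D : V → V → Prop} {S : Set V} {a b : V}
    (h : RIn D S a b) : ∃ l, IsDipath D a b l ∧ ∀ x ∈ l, x ∈ S := by
  obtain ⟨ha, h⟩ := h
  have hb : b ∈ S := RIn.right_mem ⟨ha, h⟩
  induction h using ReflTransGen.head_induction_on with
  | refl => exact ⟨[b], ⟨List.isChain_singleton b, by simp, by simp, by simp⟩, by simpa using hb⟩
  | @head a c hac hcb ih =>
    obtain ⟨l, ⟨h1, h2, h3, h4⟩, hl⟩ := ih hac.2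
    by_cases hal : a ∈ l
    · obtain ⟨s, t, rfl⟩ := List.append_of_mem hal
      refine ⟨a :: t, ⟨?_, rfl, ?_, ?_⟩, ?_⟩
      · exact (List.isChain_append.1 h1).2.1
      · simpa using h3
      · exact (List.nodup_append.1 h4).2.1
      · intro x hx; exact hl x (List.mem_append_right _ hx)
    · cases l with
      | nil => simp at h2
      | cons d t =>
        have hdc : d = c := by simpa using h2
        subst hdc
        refine ⟨a :: d :: t, ⟨?_, rfl, ?_, ?_⟩, ?_⟩
        · exact List.isChain_cons_cons.2 ⟨hac.1, h1⟩
        · simpa using h3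
        · exact List.nodup_cons.2 ⟨hal, h4⟩
        · intro x hx
          rcases List.mem_cons.1 hx with rfl | hx
          · exact ha
          · exact hl x hx

theorem IsDipath.rIn {V : Type*} {D : V → V → Prop} {S : Set V} {a b : V} {l : List V}
    (h : IsDipath D a b l) (hS : ∀ x ∈ l, x ∈ S) : RIn D S a b := by
  obtain ⟨h1, h2, h3, -⟩ := h
  induction l generalizing a with
  | nil => simp at h2
  | cons c t ih =>
    have hca : c = a := by simpa using h2
    subst hca
    cases t with
    | nil =>
      have hcb : c = b := by simpa using h3
      subst hcb
      exact ⟨hS c (by simp), .refl⟩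
    | cons d t =>
      have h1' := List.isChain_cons_cons.1 h1
      have hrec := ih (a := d) (fun x hx => hS x (List.mem_cons_of_mem _ hx)) h1'.2 rfl
        (by simpa using h3)
      exact ⟨hS c (by simp), .head ⟨h1'.1, hrec.1⟩ hrec.2⟩

theorem IsDipath.left_mem {V : Type*} {D : V → V → Prop} {a b : V} {l : List V}
    (h : IsDipath D a b l) : a ∈ l := List.mem_of_mem_head? h.2.1

theorem IsDipath.right_mem {V : Type*} {D : V → V → Prop} {a b : V} {l : List V}
    (h : IsDipath D a b l) : b ∈ l := List.mem_of_mem_getLast? h.2.2.1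

/-- Inside a set missing at most one vertex, one of two paths survives. -/
theorem survive {V : Type*} {S : Set V} (hS : ∀ a b, a ∉ S → b ∉ S → a = b)
    {l₁ l₂ : List V} (h : ∀ x, x ∈ l₁ → x ∈ l₂ → x ∈ S) :
    (∀ x ∈ l₁, x ∈ S) ∨ (∀ x ∈ l₂, x ∈ S) := by
  by_contra hcon
  push Not at hcon
  obtain ⟨⟨x, hx, hxS⟩, y, hy, hyS⟩ := hcon
  have := hS x y hxS hyS
  subst this
  exact hxS (h x hx hy)

theorem TwoVCin.rIn {V : Type*} {D : V → V → Prop} {X S : Set V} (hX : TwoVCin D X)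
    (hS : ∀ a b, a ∉ S → b ∉ S → a = b) {u w : V} (hu : u ∈ X) (hw : w ∈ X)
    (huS : u ∈ S) (hwS : w ∈ S) : RIn D S u w := by
  by_cases huw : u = w
  · subst huw; exact ⟨huS, .refl⟩
  obtain ⟨l₁, l₂, h1, h2, h⟩ := hX.2 u hu w hw huw
  rcases survive hS (l₁ := l₁) (l₂ := l₂)
    (fun x hx hx' => by rcases h x hx hx' with rfl | rfl <;> assumption) with hh | hh
  · exact h1.rIn hh
  · exact h2.rIn hh

theorem paths_of_rIn {V : Type*} {D : V → V → Prop} {u w : V} (huw : u ≠ w)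
    (h : ∀ S : Set V, (∀ a b, a ∉ S → b ∉ S → a = b) → u ∈ S → w ∈ S → RIn D S u w) :
    ∃ l₁ l₂ : List V, IsDipath D u w l₁ ∧ IsDipath D u w l₂ ∧
      ∀ x, x ∈ l₁ → x ∈ l₂ → x = u ∨ x = w := by
  obtain ⟨S, T, hS, hT, hST⟩ : HasPair D u w := by
    refine hasPair_of_avoid huw (h _ (fun a b ha => absurd trivial ha) trivial trivial) ?_
    intro z hzu hzw
    refine h _ ?_ (Ne.symm hzu) (Ne.symm hzw)
    intro a b ha hb
    simp only [Set.mem_compl_iff, Set.mem_singleton_iff, not_not] at ha hb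
    rw [ha, hb]
  obtain ⟨l₁, h1, h1'⟩ := hS.exists_dipath
  obtain ⟨l₂, h2, h2'⟩ := hT.exists_dipath
  exact ⟨l₁, l₂, h1, h2, fun x hx hx' => hST x (h1' x hx) (h2' x hx')⟩

/-- Extension proposition: if D is 2-vertex-connected in X and v not in X has two
(v,X)-paths meeting only in v and two (X,v)-paths meeting only in v, then
D is 2-vertex-connected in X together with v. -/
theorem stmt_3 {V : Type*} (D : V → V → Prop) (X : Set V) (v : V)
    (hX : TwoVCin D X) (hv : v ∉ X) (hp : PathPairs D X v) :
    TwoVCin D (X ∪ {v}) := by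
  obtain ⟨⟨l₁, l₂, ⟨x₁, hx₁, h1⟩, ⟨x₂, hx₂, h2⟩, hl⟩,
    ⟨m₁, m₂, ⟨y₁, hy₁, k1⟩, ⟨y₂, hy₂, k2⟩, hm⟩⟩ := hp
  refine ⟨hX.1, ?_⟩
  rintro u (hu | hu) w (hw | hw) huw
  · exact hX.2 u hu w hw huw
  · have hwv : w = v := hw
    subst hwv
    refine paths_of_rIn huw fun S hS huS hwS => ?_
    rcases survive hS (fun x hx hx' => (hm x hx hx') ▸ hwS) with hh | hh
    · exact (hX.rIn hS hu hy₁ huS (hh _ k1.left_mem)).trans (k1.rIn hh)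
    · exact (hX.rIn hS hu hy₂ huS (hh _ k2.left_mem)).trans (k2.rIn hh)
  · have huv : u = v := hu
    subst huv
    refine paths_of_rIn huw fun S hS huS hwS => ?_
    rcases survive hS (fun x hx hx' => (hl x hx hx') ▸ huS) with hh | hh
    · exact (h1.rIn hh).trans (hX.rIn hS hx₁ hw (hh _ h1.right_mem) hwS)
    · exact (h2.rIn hh).trans (hX.rIn hS hx₂ hw (hh _ h2.right_mem) hwS)
  · exact absurd (Eq.trans hu (Eq.symm hw)) huw
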